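/- arXiv:1205.2124 — 2 statements merged into one kernel-verified Lean document; each statement's English description precedes it below -/
import Mathlib

section
/- Let N ≥ 3 be a natural number and let u : ℝ^N → ℂ be a smooth, compactly supported function. Then ∫_{ℝ^N} |x|^{-2} |u(x)|² dx ≤ (2/(N-2))² ∫_{ℝ^N} ‖∇u(x)‖² dx (Hardy's inequality). -/
open MeasureTheory

section Hardy

variable {N : ℕ}

local notation "E" => EuclideanSpace ℝ (Fin N)

/-- The integral of a directional derivative of a compactly supported `C¹` function vanishes. -/
lemma integral_fderiv_apply_eq_zero {g : E → ℝ} (hg : ContDiff ℝ 1 g) (hs : HasCompactSupport g)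
    (v : E) : ∫ x, fderiv ℝ g x v = 0 := by
  have hint : Integrable (fun x => fderiv ℝ g x v) :=
    ((hg.continuous_fderiv one_ne_zero).clm_apply continuous_const).integrable_of_hasCompactSupport
      (hs.fderiv_apply ℝ v)
  have h := integral_mul_fderiv_eq_neg_fderiv_mul_of_integrable (μ := volume)
    (f := fun _ : E => (1 : ℝ)) (g := g) (v := v) (by simp)
    (by simpa using hint)
    (by simpa using hg.continuous.integrable_of_hasCompactSupport hs)
    (fun x _ => differentiableAt_const 1) (fun x _ => hg.differentiable one_ne_zero x)
  simpa using h

/-- The `j`-th component of the vector field `‖u‖² x / (‖x‖² + ε)`. -/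
noncomputable def hardyField (ε : ℝ) (u : E → ℂ) (j : Fin N) (x : E) : ℝ :=
  x j * (‖x‖ ^ 2 + ε)⁻¹ * ‖u x‖ ^ 2

lemma contDiff_hardyField {ε : ℝ} (hε : 0 < ε) {u : E → ℂ} (hu : ContDiff ℝ 1 u) (j : Fin N) :
    ContDiff ℝ 1 (hardyField ε u j) := by
  have hx : ContDiff ℝ 1 (fun x : E => x j) := (EuclideanSpace.proj (𝕜 := ℝ) j).contDiff
  refine (hx.mul (((contDiff_norm_sq ℝ).add contDiff_const).inv fun x => ?_)).mul (hu.norm_sq ℝ)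
  positivity

lemma hasCompactSupport_hardyField (ε : ℝ) {u : E → ℂ} (hs : HasCompactSupport u) (j : Fin N) :
    HasCompactSupport (hardyField ε u j) :=
  hs.mono' fun x hx => subset_closure fun h0 => hx (by simp [hardyField, h0])

lemma fderiv_hardyField_single {ε : ℝ} (hε : 0 < ε) {u : E → ℂ} (hu : ContDiff ℝ 1 u)
    (j : Fin N) (x : E) :
    fderiv ℝ (hardyField ε u j) x (EuclideanSpace.single j 1) =
      (‖x‖ ^ 2 + ε)⁻¹ * ‖u x‖ ^ 2 - 2 * x j ^ 2 * (‖x‖ ^ 2 + ε)⁻¹ ^ 2 * ‖u x‖ ^ 2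
        + 2 * x j * (‖x‖ ^ 2 + ε)⁻¹
          * inner ℝ (u x) (fderiv ℝ u x (EuclideanSpace.single j 1)) := by
  have hne : ‖x‖ ^ 2 + ε ≠ 0 := by positivity
  have hx : HasFDerivAt (fun x : E => x j) (EuclideanSpace.proj (𝕜 := ℝ) j) x :=
    (EuclideanSpace.proj (𝕜 := ℝ) j).hasFDerivAt
  have hw := (hasDerivAt_inv hne).comp_hasFDerivAt x
    (((hasFDerivAt_id x).norm_sq).add_const ε)
  have hn := ((hu.differentiable one_ne_zero x).hasFDerivAt).norm_sq
  have h : HasFDerivAt (hardyField ε u j) _ x := (hx.mul hw).mul hn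
  rw [h.fderiv]
  simp [EuclideanSpace.inner_single_right]
  field_simp
  ring

lemma hardy_pointwise {ε : ℝ} (hε : 0 < ε) (hN : 3 ≤ N) {u : E → ℂ} (hu : ContDiff ℝ 1 u)
    (x : E) :
    (((N : ℝ) - 2) / 2) ^ 2 * ((‖x‖ ^ 2 + ε)⁻¹ * ‖u x‖ ^ 2) ≤
      ∑ j : Fin N, ‖fderiv ℝ u x (EuclideanSpace.single j 1)‖ ^ 2
        + ((N : ℝ) - 2) / 2
          * ∑ j : Fin N, fderiv ℝ (hardyField ε u j) x (EuclideanSpace.single j 1) := by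
  have hN' : (3 : ℝ) ≤ N := by exact_mod_cast hN
  simp_rw [fderiv_hardyField_single hε hu]
  set w := (‖x‖ ^ 2 + ε)⁻¹ with hw
  have hw0 : 0 < w := by positivity
  have hw1 : ‖x‖ ^ 2 * w ≤ 1 := by
    rw [hw, ← div_eq_mul_inv, div_le_one (by positivity)]
    linarith
  obtain ⟨c, hc⟩ : ∃ c, c = ((N : ℝ) - 2) / 2 := ⟨_, rfl⟩
  have hc0 : 0 < c := by rw [hc]; linarith
  have hNc : (N : ℝ) = 2 * c + 2 := by rw [hc]; ring
  rw [← hc]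
  set a : Fin N → ℂ := fun j => fderiv ℝ u x (EuclideanSpace.single j 1)
  have hx : ∑ j : Fin N, x j ^ 2 = ‖x‖ ^ 2 := (EuclideanSpace.real_norm_sq_eq x).symm
  have hsq (j : Fin N) : 0 ≤ ‖a j‖ ^ 2 + 2 * c * (x j * w * inner ℝ (u x) (a j))
      + c ^ 2 * w ^ 2 * ‖u x‖ ^ 2 * x j ^ 2 := by
    have h := norm_add_sq_real (a j) ((c * x j * w) • u x)
    rw [inner_smul_right, norm_smul, mul_pow, Real.norm_eq_abs, sq_abs,
      real_inner_comm] at h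
    nlinarith [sq_nonneg ‖a j + (c * x j * w) • u x‖]
  have hsum := Finset.sum_nonneg fun j (_ : j ∈ Finset.univ) => hsq j
  rw [Finset.sum_add_distrib, Finset.sum_add_distrib, ← Finset.mul_sum, ← Finset.mul_sum, hx]
    at hsum
  have hdiv : ∑ j : Fin N, (w * ‖u x‖ ^ 2 - 2 * x j ^ 2 * w ^ 2 * ‖u x‖ ^ 2
        + 2 * x j * w * inner ℝ (u x) (a j))
      = N * (w * ‖u x‖ ^ 2) - 2 * w ^ 2 * ‖u x‖ ^ 2 * ‖x‖ ^ 2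
        + 2 * ∑ j : Fin N, x j * w * inner ℝ (u x) (a j) := by
    rw [Finset.sum_add_distrib, Finset.sum_sub_distrib, ← hx, Finset.mul_sum, Finset.mul_sum]
    simp only [Finset.sum_const, Finset.card_univ, Fintype.card_fin, nsmul_eq_mul]
    congr 2
    · exact Finset.sum_congr rfl fun j _ => by ring
    · exact funext fun j => by ring
  have hslack : 0 ≤ (c ^ 2 + 2 * c) * (w * ‖u x‖ ^ 2) * (1 - ‖x‖ ^ 2 * w) :=
    mul_nonneg (by positivity) (by linarith)
  rw [hdiv, hNc]
  nlinarith

lemma integral_hardy_regularized {ε : ℝ} (hε : 0 < ε) (hN : 3 ≤ N) {u : E → ℂ}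
    (hu : ContDiff ℝ 1 u) (hs : HasCompactSupport u) :
    ∫ x : E, (‖x‖ ^ 2 + ε)⁻¹ * ‖u x‖ ^ 2 ≤
      (2 / ((N : ℝ) - 2)) ^ 2 *
        ∫ x : E, ∑ j : Fin N, ‖fderiv ℝ u x (EuclideanSpace.single j 1)‖ ^ 2 := by
  have hN' : (3 : ℝ) ≤ N := by exact_mod_cast hN
  have hleft : Integrable fun x : E => (‖x‖ ^ 2 + ε)⁻¹ * ‖u x‖ ^ 2 := by
    refine Continuous.integrable_of_hasCompactSupport ?_
      (hs.mono' fun x hx => subset_closure fun h0 => hx (by simp [h0]))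
    have : ∀ x : E, ‖x‖ ^ 2 + ε ≠ 0 := fun x => by positivity
    have := hu.continuous
    fun_prop (disch := assumption)
  have hgrad : Integrable fun x : E =>
      ∑ j : Fin N, ‖fderiv ℝ u x (EuclideanSpace.single j 1)‖ ^ 2 := by
    refine integrable_finsetSum _ fun j _ => Continuous.integrable_of_hasCompactSupport
      (((hu.continuous_fderiv one_ne_zero).clm_apply continuous_const).norm.pow 2) ?_
    exact (hs.fderiv_apply ℝ (EuclideanSpace.single j 1)).comp_left (g := fun z => ‖z‖ ^ 2)
      (by simp)
  have hfield (j : Fin N) : Integrable fun x : E =>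
      fderiv ℝ (hardyField ε u j) x (EuclideanSpace.single j 1) :=
    (((contDiff_hardyField hε hu j).continuous_fderiv one_ne_zero).clm_apply
      continuous_const).integrable_of_hasCompactSupport
        ((hasCompactSupport_hardyField ε hs j).fderiv_apply ℝ _)
  have hfields := integrable_finsetSum Finset.univ fun j _ => hfield j
  have h := integral_mono (hleft.const_mul _) (hgrad.add (hfields.const_mul _))
    fun x => hardy_pointwise hε hN hu x
  simp only [Pi.add_apply] at h
  rw [integral_add hgrad (hfields.const_mul _), integral_const_mul, integral_const_mul,
    integral_finsetSum _ fun j _ => hfield j,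
    Finset.sum_eq_zero fun j _ => integral_fderiv_apply_eq_zero (contDiff_hardyField hε hu j)
      (hasCompactSupport_hardyField ε hs j) _, mul_zero, add_zero] at h
  have hpos : 0 < ((N : ℝ) - 2) / 2 := by linarith
  rw [← inv_div ((N : ℝ) - 2) 2, inv_pow]
  exact (le_inv_mul_iff₀ (by positivity)).2 h

end Hardy

/-- **Hardy's inequality.** For `N ≥ 3` and any smooth compactly supported
`u : ℝ^N → ℂ`, one has
`∫ |x|⁻² |u(x)|² dx ≤ (2/(N-2))² ∫ ‖∇u(x)‖² dx`,
where `‖∇u(x)‖² = ∑ⱼ |∂ⱼu(x)|²`. -/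
theorem hardy_inequality (N : ℕ) (hN : 3 ≤ N)
    (u : EuclideanSpace ℝ (Fin N) → ℂ)
    (hu : ContDiff ℝ (⊤ : ℕ∞) u) (hsupp : HasCompactSupport u) :
    ∫ x : EuclideanSpace ℝ (Fin N), (‖x‖ ^ 2)⁻¹ * ‖u x‖ ^ 2 ≤
      (2 / ((N : ℝ) - 2)) ^ 2 *
        ∫ x : EuclideanSpace ℝ (Fin N),
          ∑ j : Fin N, ‖fderiv ℝ u x (EuclideanSpace.single j 1)‖ ^ 2 := by
  have hu1 : ContDiff ℝ 1 u := hu.of_le (by exact_mod_cast le_top)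
  by_cases hint : Integrable fun x : EuclideanSpace ℝ (Fin N) => (‖x‖ ^ 2)⁻¹ * ‖u x‖ ^ 2
  swap
  · rw [integral_undef hint]
    exact mul_nonneg (sq_nonneg _) (integral_nonneg fun x => by positivity)
  have : Nonempty (Fin N) := ⟨⟨0, by omega⟩⟩
  have hae : ∀ᵐ x : EuclideanSpace ℝ (Fin N), x ≠ 0 := Measure.ae_ne volume 0
  have hlim : Filter.Tendsto (fun ε : ℝ => ∫ x : EuclideanSpace ℝ (Fin N),
      (‖x‖ ^ 2 + ε)⁻¹ * ‖u x‖ ^ 2) (nhdsWithin 0 (Set.Ioi 0))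
      (nhds (∫ x : EuclideanSpace ℝ (Fin N), (‖x‖ ^ 2)⁻¹ * ‖u x‖ ^ 2)) := by
    refine tendsto_integral_filter_of_dominated_convergence _ ?_ ?_ hint ?_
    · filter_upwards with ε
      have := hu.continuous.measurable
      exact (by fun_prop : Measurable _).aestronglyMeasurable
    · filter_upwards [self_mem_nhdsWithin] with ε hε
      filter_upwards [hae] with x hx
      have hε' : 0 < ε := hε
      rw [Real.norm_of_nonneg (by positivity)]
      gcongr
      linarith
    · filter_upwards [hae] with x hx
      have hx' : ‖x‖ ^ 2 + 0 ≠ 0 := by simpa using hx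
      have h : ContinuousAt (fun ε : ℝ => (‖x‖ ^ 2 + ε)⁻¹ * ‖u x‖ ^ 2) 0 := by
        fun_prop (disch := assumption)
      simpa using h.tendsto.mono_left nhdsWithin_le_nhds
  refine le_of_tendsto hlim ?_
  filter_upwards [self_mem_nhdsWithin] with ε hε
  exact integral_hardy_regularized hε hN hu1 hsupp
end

section
/- Let Z ∈ ℝ with Z ≥ -1/4 and let u : ℝ³ → ℂ be a smooth function whose (compact) support is contained in ℝ³ ∖ {0}. Then ∫_{ℝ³} ‖∇u(x)‖² dx + Z ∫_{ℝ³} |x|^{-2} |u(x)|² dx ≥ 0; that is, the quadratic form of the Schrödinger operator -Δ + Z|x|^{-2} is nonnegative on C_c^∞(ℝ³ ∖ {0}). -/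
open MeasureTheory

/-- The integral of a directional derivative of a compactly supported `C¹` function vanishes. -/
theorem integral_fderiv_apply_eq_zero_of_hasCompactSupport {E : Type*} [NormedAddCommGroup E]
    [NormedSpace ℝ E] [FiniteDimensional ℝ E] [MeasurableSpace E] [BorelSpace E]
    (μ : Measure E) [μ.IsAddHaarMeasure] {f : E → ℝ} (hf : ContDiff ℝ 1 f)
    (hc : HasCompactSupport f) (v : E) : ∫ x, fderiv ℝ f x v ∂μ = 0 := by
  have hint : Integrable (fun x => fderiv ℝ f x v) μ :=
    ((hf.continuous_fderiv one_ne_zero).clm_apply continuous_const).integrable_of_hasCompactSupport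
      (hc.fderiv_apply ℝ v)
  have := integral_mul_fderiv_eq_neg_fderiv_mul_of_integrable (𝕜 := ℝ) (μ := μ) (v := v)
    (f := fun _ => (1 : ℝ)) (g := f) (by simp) (by simpa using hint)
    (by simpa using hf.continuous.integrable_of_hasCompactSupport hc)
    (by fun_prop) (fun x _ => hf.differentiable one_ne_zero x)
  simpa using this

/-- The derivative of `x ↦ x_j |x|⁻² |u(x)|²` in the direction `e_j`, away from the origin. -/
theorem fderiv_coord_mul_invSquare_mul_normSq {n : ℕ} {u : EuclideanSpace ℝ (Fin n) → ℂ}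
    {x : EuclideanSpace ℝ (Fin n)} (hu : DifferentiableAt ℝ u x) (hx : x ≠ 0) (j : Fin n) :
    fderiv ℝ (fun y : EuclideanSpace ℝ (Fin n) => y j * ((‖y‖ ^ 2)⁻¹ * ‖u y‖ ^ 2)) x
        (EuclideanSpace.single j 1) =
      (‖x‖ ^ 2)⁻¹ * ‖u x‖ ^ 2 - 2 * x j ^ 2 * ((‖x‖ ^ 2)⁻¹) ^ 2 * ‖u x‖ ^ 2 +
        2 * x j * (‖x‖ ^ 2)⁻¹ *
          inner ℝ (u x) (fderiv ℝ u x (EuclideanSpace.single j 1)) := by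
  have hr : ‖x‖ ^ 2 ≠ 0 := by simpa using hx
  have h1 : HasFDerivAt (fun y : EuclideanSpace ℝ (Fin n) => y j)
      (EuclideanSpace.proj j : EuclideanSpace ℝ (Fin n) →L[ℝ] ℝ) x :=
    (EuclideanSpace.proj j : EuclideanSpace ℝ (Fin n) →L[ℝ] ℝ).hasFDerivAt
  have h2 := (hasDerivAt_inv hr).comp_hasFDerivAt x (hasFDerivAt_id x).norm_sq
  have h3 := hu.hasFDerivAt.norm_sq
  have h := h1.mul (h2.mul h3)
  refine (congrArg (fun L => L (EuclideanSpace.single j 1)) h.fderiv).trans ?_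
  simp [EuclideanSpace.inner_single_right]
  field_simp
  ring

/-- Pointwise lower bound for the gradient obtained by expanding
`∑ j, |∂_j u + x_j u / (2|x|²)|² ≥ 0`. -/
theorem sum_normSq_fderiv_add_divergence_nonneg {u : EuclideanSpace ℝ (Fin 3) → ℂ}
    {x : EuclideanSpace ℝ (Fin 3)} (hu : DifferentiableAt ℝ u x) (hx : x ≠ 0) :
    0 ≤ (∑ j : Fin 3, ‖fderiv ℝ u x (EuclideanSpace.single j 1)‖ ^ 2) -
      1 / 4 * ((‖x‖ ^ 2)⁻¹ * ‖u x‖ ^ 2) +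
      1 / 2 * ∑ j : Fin 3,
        fderiv ℝ (fun y : EuclideanSpace ℝ (Fin 3) => y j * ((‖y‖ ^ 2)⁻¹ * ‖u y‖ ^ 2)) x
          (EuclideanSpace.single j 1) := by
  simp only [fderiv_coord_mul_invSquare_mul_normSq hu hx]
  have hr : ‖x‖ ^ 2 ≠ 0 := by simpa using hx
  have hsum : ‖x‖ ^ 2 = x 0 ^ 2 + x 1 ^ 2 + x 2 ^ 2 := by
    simp [EuclideanSpace.norm_sq_eq, Fin.sum_univ_three]
  set t := (‖x‖ ^ 2)⁻¹ with ht
  have htr : (x 0 ^ 2 + x 1 ^ 2 + x 2 ^ 2) * t = 1 := by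
    rw [← hsum, ht, mul_inv_cancel₀ hr]
  have key : ∀ j : Fin 3, 0 ≤ ‖fderiv ℝ u x (EuclideanSpace.single j 1)‖ ^ 2 +
      x j * t * inner ℝ (u x) (fderiv ℝ u x (EuclideanSpace.single j 1)) +
      x j ^ 2 * t ^ 2 / 4 * ‖u x‖ ^ 2 := by
    intro j
    have h := sq_nonneg
      ‖fderiv ℝ u x (EuclideanSpace.single j 1) + (x j * t / 2) • u x‖
    rw [norm_add_sq_real, real_inner_smul_right, norm_smul, mul_pow, Real.norm_eq_abs, sq_abs,
      real_inner_comm] at h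
    linarith
  have k := add_nonneg (add_nonneg (key 0) (key 1)) (key 2)
  simp only [Fin.sum_univ_three]
  linear_combination k + (5 / 4 * t * ‖u x‖ ^ 2) * htr

/-- For `Z ≥ -1/4` and `u : ℝ³ → ℂ` smooth with compact support contained in
`ℝ³ ∖ {0}`, the quadratic form of the Schrödinger operator `-Δ + Z|x|⁻²` is
nonnegative:
`∫ ‖∇u(x)‖² dx + Z ∫ |x|⁻² |u(x)|² dx ≥ 0`. -/
theorem invSquare_form_nonneg (Z : ℝ) (hZ : -(1/4 : ℝ) ≤ Z)
    (u : EuclideanSpace ℝ (Fin 3) → ℂ)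
    (hu : ContDiff ℝ (⊤ : ℕ∞) u) (hsupp : HasCompactSupport u)
    (h0 : tsupport u ⊆ ({0} : Set (EuclideanSpace ℝ (Fin 3)))ᶜ) :
    0 ≤ (∫ x : EuclideanSpace ℝ (Fin 3),
          ∑ j : Fin 3, ‖fderiv ℝ u x (EuclideanSpace.single j 1)‖ ^ 2) +
        Z * ∫ x : EuclideanSpace ℝ (Fin 3), (‖x‖ ^ 2)⁻¹ * ‖u x‖ ^ 2 := by
  have hu1 : ContDiff ℝ 1 u := hu.of_le (by exact_mod_cast le_top)
  set g : EuclideanSpace ℝ (Fin 3) → ℝ := fun x => (‖x‖ ^ 2)⁻¹ * ‖u x‖ ^ 2 with hg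
  have hsub : Function.support g ⊆ Function.support u := by
    intro x hx hux
    exact hx (by simp [hg, hux])
  have hgc : HasCompactSupport g := hsupp.mono hsub
  have hgd : ContDiff ℝ 1 g := by
    refine (contMDiff_of_tsupport fun x hx => contMDiffAt_iff_contDiffAt.2 ?_).contDiff
    have hx0 : x ≠ 0 := h0 (closure_mono hsub hx)
    exact ((contDiff_norm_sq ℝ).contDiffAt.inv (by simpa using hx0)).mul
      (hu1.norm_sq ℝ).contDiffAt
  have hfd : ∀ j : Fin 3, ContDiff ℝ 1 fun x : EuclideanSpace ℝ (Fin 3) => x j * g x :=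
    fun j => (EuclideanSpace.proj j : EuclideanSpace ℝ (Fin 3) →L[ℝ] ℝ).contDiff.mul hgd
  have hfc : ∀ j : Fin 3, HasCompactSupport fun x : EuclideanSpace ℝ (Fin 3) => x j * g x :=
    fun j => hgc.mul_left
  have hgi : Integrable g := hgd.continuous.integrable_of_hasCompactSupport hgc
  have hui : Integrable fun x : EuclideanSpace ℝ (Fin 3) =>
      ∑ j : Fin 3, ‖fderiv ℝ u x (EuclideanSpace.single j 1)‖ ^ 2 := by
    refine integrable_finsetSum _ fun j _ => ?_
    refine Continuous.integrable_of_hasCompactSupport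
      (((hu1.continuous_fderiv one_ne_zero).clm_apply continuous_const).norm.pow 2) ?_
    exact (hsupp.fderiv_apply ℝ (EuclideanSpace.single j 1)).comp_left
      (g := fun z : ℂ => ‖z‖ ^ 2) (by simp)
  have hdi : ∀ j : Fin 3, Integrable fun x : EuclideanSpace ℝ (Fin 3) =>
      fderiv ℝ (fun y : EuclideanSpace ℝ (Fin 3) => y j * g y) x (EuclideanSpace.single j 1) :=
    fun j => (((hfd j).continuous_fderiv one_ne_zero).clm_apply
      continuous_const).integrable_of_hasCompactSupport ((hfc j).fderiv_apply ℝ _)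
  have hdsi := integrable_finsetSum Finset.univ fun j _ => hdi j
  have hdiv : ∫ x : EuclideanSpace ℝ (Fin 3), ∑ j : Fin 3,
      fderiv ℝ (fun y : EuclideanSpace ℝ (Fin 3) => y j * g y) x
        (EuclideanSpace.single j 1) = 0 := by
    rw [integral_finsetSum _ fun j _ => hdi j]
    exact Finset.sum_eq_zero fun j _ =>
      integral_fderiv_apply_eq_zero_of_hasCompactSupport volume (hfd j) (hfc j) _
  have hmain : 0 ≤ ∫ x : EuclideanSpace ℝ (Fin 3),
      ((∑ j : Fin 3, ‖fderiv ℝ u x (EuclideanSpace.single j 1)‖ ^ 2) - 1 / 4 * g x +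
        1 / 2 * ∑ j : Fin 3, fderiv ℝ (fun y : EuclideanSpace ℝ (Fin 3) => y j * g y) x
          (EuclideanSpace.single j 1)) :=
    integral_nonneg_of_ae <| (Measure.ae_ne volume 0).mono fun x hx =>
      sum_normSq_fderiv_add_divergence_nonneg (hu1.differentiable one_ne_zero x) hx
  rw [integral_add (by exact hui.sub (hgi.const_mul _)) (hdsi.const_mul _),
    integral_sub hui (hgi.const_mul _), integral_const_mul, integral_const_mul, hdiv] at hmain
  have hg0 : 0 ≤ ∫ x, g x := integral_nonneg fun x => by positivity
  linarith [mul_le_mul_of_nonneg_right hZ hg0]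
end
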